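/- Let d ≥ 1 and n ≥ 2 be integers and let α be a real number with d ≤ α < dn. Let Z ⊆ ℝ^{dn} be a countable union of compact sets, each of lower Minkowski dimension at most α. Then there exists a set X ⊆ [0,1)^d with Hausdorff dimension at least (nd − α)/(n − 1) such that for every n-tuple of pairwise distinct points x_1, …, x_n ∈ X one has (x_1, …, x_n) ∉ Z. -/

import Mathlib

open Filter Set

noncomputable section

/-- A dyadic length: a real number of the form `2 ^ (-k)` for a natural number `k`. -/
def IsDyadicLength (l : ℝ) : Prop := ∃ k : ℕ, l = (2 : ℝ) ^ (-(k : ℤ))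

/-- The half-open dyadic cube of sidelength `l` with corner `l • m`. -/
def dyadicCube {ι : Type*} (l : ℝ) (m : ι → ℤ) : Set (ι → ℝ) :=
  {x | ∀ i, l * (m i : ℝ) ≤ x i ∧ x i < l * ((m i : ℝ) + 1)}

/-- The (indices of the) cubes of `B_l` that intersect `E`. -/
def cubesMeeting {ι : Type*} (l : ℝ) (E : Set (ι → ℝ)) : Set (ι → ℤ) :=
  {m | (dyadicCube l m ∩ E).Nonempty}

/-- `#B_l(E)`, the number of cubes of sidelength `l` meeting `E`. -/
def cubeCount {ι : Type*} (l : ℝ) (E : Set (ι → ℝ)) : ℕ :=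
  (cubesMeeting l E).ncard

/-- `E` is a union of cubes of `B_l`. -/
def IsCubeUnion {ι : Type*} (l : ℝ) (E : Set (ι → ℝ)) : Prop :=
  ∃ S : Set (ι → ℤ), E = ⋃ m ∈ S, dyadicCube l m

/-- Lower Minkowski dimension, computed along dyadic scales. -/
def lowerMinkDim {ι : Type*} (Z : Set (ι → ℝ)) : ℝ :=
  Filter.atTop.liminf fun k : ℕ =>
    Real.log (cubeCount ((2 : ℝ) ^ (-(k : ℤ))) Z) / (k * Real.log 2)

/-- The unit cube `[0,1)^d`. -/
def unitCube (d : ℕ) : Set (Fin d → ℝ) := {x | ∀ i, x i ∈ Set.Ico (0 : ℝ) 1}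

/-- `X^n`, viewed inside `ℝ^{dn} = (Fin n × Fin d → ℝ)`. -/
def nthPower {d n : ℕ} (X : Set (Fin d → ℝ)) : Set (Fin n × Fin d → ℝ) :=
  {y | ∀ j, (fun i => y (j, i)) ∈ X}

/-- The point `(x_1, …, x_n) ∈ ℝ^{dn}` built from `x_1, …, x_n ∈ ℝ^d`. -/
def tuple {d n : ℕ} (x : Fin n → Fin d → ℝ) : Fin n × Fin d → ℝ := fun p => x p.1 p.2

/-- The `j`-th factor of a cube index in `B_l^{dn}`. -/
def cubeRow {d n : ℕ} (M : Fin n × Fin d → ℤ) (j : Fin n) : Fin d → ℤ := fun i => M (j, i)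

/-- A cube of `B_l^{dn}` is strongly non-diagonal if its `n` factors are pairwise distinct. -/
def StronglyNonDiagonal {d n : ℕ} (M : Fin n × Fin d → ℤ) : Prop :=
  Function.Injective (cubeRow M)

/-- A random function `R → S` matches a prescribed tuple of `n` values at `n` distinct points with
probability `|S| ^ (-n)`; hence some function matches at most the expected number of the tuples. -/
lemma exists_function_few_matches {R S : Type*} [Fintype R] [DecidableEq R] [Fintype S]
    [DecidableEq S] [Nonempty S] {n : ℕ} (B : Finset (Fin n → R × S))
    (hB : ∀ t ∈ B, Function.Injective fun j => (t j).1) :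
    ∃ f : R → S, (B.filter fun t => ∀ j, f (t j).1 = (t j).2).card * Fintype.card S ^ n
      ≤ B.card := by
  have single : ∀ t ∈ B, ((Finset.univ : Finset (R → S)).filter
      fun f => ∀ j, f (t j).1 = (t j).2).card * Fintype.card S ^ n ≤ Fintype.card (R → S) := by
    intro t ht
    have hcard : Fintype.card S ^ n = (Finset.univ : Finset (Fin n → S)).card := by simp
    rw [hcard, ← Finset.card_product, ← Finset.card_univ (α := R → S)]
    refine Finset.card_le_card_of_injOn
      (fun p : (R → S) × (Fin n → S) => Function.extend (fun j => (t j).1) p.2 p.1)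
      (fun _ _ => Finset.mem_coe.2 (Finset.mem_univ _)) ?_
    rintro ⟨f, g⟩ hfg ⟨f', g'⟩ hfg' h
    simp only [Finset.coe_product, Finset.coe_filter, Finset.mem_univ, true_and,
      Set.mem_prod, Set.mem_ofPred_eq, Finset.coe_univ, Set.mem_univ, and_true] at hfg hfg' h
    refine Prod.ext (funext fun r => ?_) (funext fun j => ?_)
    · by_cases hr : ∃ j, (t j).1 = r
      · obtain ⟨j, rfl⟩ := hr
        exact (hfg j).trans (hfg' j).symm
      · have := congrFun h r
        rwa [Function.extend_apply' _ _ _ hr, Function.extend_apply' _ _ _ hr] at this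
    · have := congrFun h (t j).1
      rwa [(hB t ht).extend_apply, (hB t ht).extend_apply] at this
  have total : ∑ f : R → S, (B.filter fun t => ∀ j, f (t j).1 = (t j).2).card * Fintype.card S ^ n
      ≤ ∑ _f : R → S, B.card := by
    calc ∑ f : R → S, (B.filter fun t => ∀ j, f (t j).1 = (t j).2).card * Fintype.card S ^ n
        = ∑ t ∈ B, ((Finset.univ : Finset (R → S)).filter
            fun f => ∀ j, f (t j).1 = (t j).2).card * Fintype.card S ^ n := by
          rw [← Finset.sum_mul, ← Finset.sum_mul]
          congr 1
          exact Finset.sum_card_bipartiteAbove_eq_sum_card_bipartiteBelow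
            (s := (Finset.univ : Finset (R → S))) (t := B)
            (fun (f : R → S) (t : Fin n → R × S) => ∀ j, f (t j).1 = (t j).2)
      _ ≤ ∑ t ∈ B, Fintype.card (R → S) := Finset.sum_le_sum single
      _ = ∑ _f : R → S, B.card := by simp [mul_comm]
  obtain ⟨f, -, hf⟩ := Finset.exists_le_of_sum_le Finset.univ_nonempty total
  exact ⟨f, hf⟩

/-- The index of the dyadic cube of generation `L + a + 1 + b` reached from the cube `m` of
generation `L` by first choosing the `a` binary digits `u`, then a digit `0`, and then the `b`
digits `v`. -/
def childIndex {ι : Type*} (a b : ℕ) (m u v : ι → ℕ) : ι → ℕ :=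
  fun j => 2 ^ (b + 1) * (2 ^ a * m j + u j) + v j

lemma mul_add_inj_of_lt {N x y x' y' : ℕ} (hy : y < N) (hy' : y' < N)
    (h : N * x + y = N * x' + y') : x = x' ∧ y = y' := by
  have hN : 0 < N := by lia
  have h1 := congrArg (· / N) h
  have h2 := congrArg (· % N) h
  simp only [Nat.mul_add_div hN, Nat.div_eq_of_lt hy, Nat.div_eq_of_lt hy', Nat.mul_add_mod,
    Nat.mod_eq_of_lt hy, Nat.mod_eq_of_lt hy', add_zero] at h1 h2
  exact ⟨h1, h2⟩

lemma childIndex_inj {ι : Type*} {a b : ℕ} {m u v m' u' v' : ι → ℕ}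
    (hu : ∀ j, u j < 2 ^ a) (hu' : ∀ j, u' j < 2 ^ a)
    (hv : ∀ j, v j < 2 ^ b) (hv' : ∀ j, v' j < 2 ^ b)
    (h : childIndex a b m u v = childIndex a b m' u' v') : m = m' ∧ u = u' ∧ v = v' := by
  have key : ∀ j, m j = m' j ∧ u j = u' j ∧ v j = v' j := by
    intro j
    have hb : 2 ^ b < 2 ^ (b + 1) := Nat.pow_lt_pow_right one_lt_two (Nat.lt_succ_self b)
    obtain ⟨h1, h2⟩ := mul_add_inj_of_lt ((hv j).trans hb) ((hv' j).trans hb) (congrFun h j)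
    obtain ⟨h3, h4⟩ := mul_add_inj_of_lt (hu j) (hu' j) h1
    exact ⟨h3, h4, h2⟩
  exact ⟨funext fun j => (key j).1, funext fun j => (key j).2.1, funext fun j => (key j).2.2⟩

/-- From every cube of generation `L` in the unit cube one can choose `M` children, in distinct
cubes of generation `L + a`, so that no tuple of distinct chosen cubes belongs to `B`. -/
lemma exists_selection {d n L a b M : ℕ} (hn : 0 < n) (hM : 2 * M ≤ (2 ^ a) ^ d)
    (B : Set (Fin n × Fin d → ℤ)) (hB : B.Finite) (hcard : B.ncard ≤ M * ((2 ^ b) ^ d) ^ n) :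
    ∃ u v : (Fin d → ℕ) → Fin M → Fin d → ℕ,
      (∀ m, Function.Injective (u m)) ∧ (∀ m i j, u m i j < 2 ^ a) ∧ (∀ m i j, v m i j < 2 ^ b) ∧
      ∀ (m : Fin n → Fin d → ℕ) (i : Fin n → Fin M), (∀ j k, m j k < 2 ^ L) →
        (Function.Injective fun j => childIndex a b (m j) (u (m j) (i j)) (v (m j) (i j))) →
        (fun q : Fin n × Fin d =>
          (childIndex a b (m q.1) (u (m q.1) (i q.1)) (v (m q.1) (i q.1)) q.2 : ℤ)) ∉ B := by
  classical
  let P := Fin d → Fin (2 ^ L)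
  let U := Fin d → Fin (2 ^ a)
  let S := Fin d → Fin (2 ^ b)
  let enc : (P × U) × S → Fin d → ℕ := fun t =>
    childIndex a b (fun k => (t.1.1 k : ℕ)) (fun k => (t.1.2 k : ℕ)) (fun k => (t.2 k : ℕ))
  have enc_inj : Function.Injective enc := by
    rintro ⟨⟨m, u⟩, v⟩ ⟨⟨m', u'⟩, v'⟩ h
    obtain ⟨h1, h2, h3⟩ := childIndex_inj (fun k => (u k).2) (fun k => (u' k).2)
      (fun k => (v k).2) (fun k => (v' k).2) h
    have e1 : m = m' := funext fun k => Fin.ext (congrFun h1 k)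
    have e2 : u = u' := funext fun k => Fin.ext (congrFun h2 k)
    have e3 : v = v' := funext fun k => Fin.ext (congrFun h3 k)
    rw [e1, e2, e3]
  let cube : (Fin n → (P × U) × S) → Fin n × Fin d → ℤ := fun t q => (enc (t q.1) q.2 : ℤ)
  have cube_inj : Function.Injective cube := by
    intro t t' h
    refine funext fun j => enc_inj (funext fun k => ?_)
    exact Nat.cast_injective (R := ℤ) (congrFun h (j, k))
  let bad : Finset (Fin n → (P × U) × S) :=
    Finset.univ.filter fun t => (Function.Injective fun j => (t j).1) ∧ cube t ∈ B
  have bad_card : bad.card ≤ B.ncard := by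
    rw [Set.ncard_eq_toFinset_card B hB]
    refine Finset.card_le_card_of_injOn cube (fun t ht => ?_) cube_inj.injOn
    simpa using (Finset.mem_filter.1 ht).2.2
  obtain ⟨f, hf⟩ := exists_function_few_matches bad fun t ht => (Finset.mem_filter.1 ht).2.1
  have hS : Fintype.card S = (2 ^ b) ^ d := by simp [S]
  rw [hS] at hf
  have matched : (bad.filter fun t => ∀ j, f (t j).1 = (t j).2).card ≤ M :=
    Nat.le_of_mul_le_mul_right (hf.trans (bad_card.trans hcard)) (by positivity)
  let D : Finset (P × U) :=
    (bad.filter fun t => ∀ j, f (t j).1 = (t j).2).image fun t => (t ⟨0, hn⟩).1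
  have hD : D.card ≤ M := Finset.card_image_le.trans matched
  have good : ∀ m : P, Nonempty (Fin M ↪ {u : U // (m, u) ∉ D}) := by
    intro m
    apply Function.Embedding.nonempty_of_card_le
    have h1 : (Finset.univ.filter fun u : U => (m, u) ∈ D).card ≤ D.card :=
      Finset.card_le_card_of_injOn (fun u => (m, u)) (fun u hu => by simpa using hu)
        (fun u _ u' _ h => (Prod.ext_iff.1 h).2)
    have h2 : Fintype.card {u : U // (m, u) ∉ D} + (Finset.univ.filter
        fun u : U => (m, u) ∈ D).card = Fintype.card U := by
      rw [Fintype.card_subtype, add_comm, Finset.card_filter_add_card_filter_not,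
        Finset.card_univ]
    have hU : Fintype.card U = (2 ^ a) ^ d := by simp [U]
    rw [Fintype.card_fin]
    lia
  let g : ∀ m : P, Fin M ↪ {u : U // (m, u) ∉ D} := fun m => (good m).some
  let red : (Fin d → ℕ) → P := fun m k => Fin.ofNat (2 ^ L) (m k)
  refine ⟨fun m i k => ((g (red m) i).1 k : ℕ), fun m i k => (f (red m, (g (red m) i).1) k : ℕ),
    fun m i i' h => (g (red m)).injective (Subtype.ext (funext fun k => Fin.ext (congrFun h k))),
    fun m i k => Fin.is_lt _, fun m i k => Fin.is_lt _, fun m i hm hinj hmem => ?_⟩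
  let t : Fin n → (P × U) × S := fun j =>
    ((red (m j), (g (red (m j)) (i j)).1), f (red (m j), (g (red (m j)) (i j)).1))
  have enc_t : ∀ j, enc (t j) = childIndex a b (m j) (fun k => ((g (red (m j)) (i j)).1 k : ℕ))
      (fun k => (f (red (m j), (g (red (m j)) (i j)).1) k : ℕ)) := by
    intro j
    have : (fun k => ((red (m j)) k : ℕ)) = m j := funext fun k => Nat.mod_eq_of_lt (hm j k)
    simp only [enc, t, this]
  have t_bad : t ∈ bad.filter fun t => ∀ j, f (t j).1 = (t j).2 := by
    refine Finset.mem_filter.2 ⟨Finset.mem_filter.2 ⟨Finset.mem_univ _, fun j j' h => hinj ?_, ?_⟩,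
      fun j => rfl⟩
    · have htt : t j = t j' := Prod.ext h (congrArg f h)
      simpa only [← enc_t] using congrArg enc htt
    · have : cube t = _ := funext fun q => congrArg Nat.cast (congrFun (enc_t q.1) q.2)
      rw [this]
      exact hmem
  exact (g (red (m ⟨0, hn⟩)) (i ⟨0, hn⟩)).2 (Finset.mem_image.2 ⟨t, t_bad, rfl⟩)

lemma mem_dyadicCube_two_pow {ι : Type*} {k : ℕ} {m : ι → ℤ} {x : ι → ℝ} :
    x ∈ dyadicCube ((2 : ℝ) ^ (-(k : ℤ))) m ↔ ∀ i, ⌊2 ^ k * x i⌋ = m i := by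
  refine forall_congr' fun i => ?_
  have hk : (0 : ℝ) < 2 ^ k := by positivity
  rw [Int.floor_eq_iff, zpow_neg, zpow_natCast, inv_mul_le_iff₀ hk, lt_inv_mul_iff₀ hk]

lemma cubesMeeting_subset_Icc {ι : Type*} {E : Set (ι → ℝ)} {A : ℕ}
    (hE : ∀ x ∈ E, ∀ i, |x i| ≤ A) (k : ℕ) :
    cubesMeeting ((2 : ℝ) ^ (-(k : ℤ))) E ⊆
      Set.Icc (fun _ => -((A : ℤ) * 2 ^ k)) (fun _ => (A : ℤ) * 2 ^ k) := by
  rintro m ⟨x, hxm, hxE⟩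
  rw [mem_dyadicCube_two_pow] at hxm
  have hk : (0 : ℝ) < 2 ^ k := by positivity
  refine ⟨fun i => ?_, fun i => ?_⟩
  · rw [← hxm i, Int.le_floor]
    push_cast
    nlinarith [(abs_le.1 (hE x hxE i)).1]
  · rw [← hxm i, ← Int.cast_le (R := ℝ)]
    refine (Int.floor_le _).trans ?_
    push_cast
    nlinarith [(abs_le.1 (hE x hxE i)).2]

lemma IsCompact.exists_nat_abs_le {ι : Type*} [Fintype ι] {E : Set (ι → ℝ)} (hE : IsCompact E) :
    ∃ A : ℕ, ∀ x ∈ E, ∀ i, |x i| ≤ A := by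
  obtain ⟨C, hC⟩ := hE.isBounded.exists_norm_le
  refine ⟨⌈C⌉₊, fun x hx i => ?_⟩
  exact ((norm_le_pi_norm x i).trans (hC x hx)).trans (Nat.le_ceil C)

lemma IsCompact.finite_cubesMeeting {ι : Type*} [Fintype ι] {E : Set (ι → ℝ)} (hE : IsCompact E)
    (k : ℕ) : (cubesMeeting ((2 : ℝ) ^ (-(k : ℤ))) E).Finite := by
  classical
  obtain ⟨A, hA⟩ := hE.exists_nat_abs_le
  exact (Set.finite_Icc _ _).subset (cubesMeeting_subset_Icc hA k)

lemma cubeCount_le {ι : Type*} [Fintype ι] {E : Set (ι → ℝ)} {A : ℕ}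
    (hE : ∀ x ∈ E, ∀ i, |x i| ≤ A) (k : ℕ) :
    cubeCount ((2 : ℝ) ^ (-(k : ℤ))) E ≤ (2 ^ (2 * A + 1 + k)) ^ Fintype.card ι := by
  classical
  refine (Set.ncard_le_ncard (cubesMeeting_subset_Icc hE k) (Set.finite_Icc _ _)).trans ?_
  rw [← Finset.coe_Icc, Set.ncard_coe_finset, Pi.card_Icc]
  simp only [Int.card_Icc, Finset.prod_const, Finset.card_univ]
  refine Nat.pow_le_pow_left ?_ _
  have h1 : 2 * A + 1 ≤ 2 ^ (2 * A + 1) := Nat.lt_two_pow_self.le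
  have h2 : 1 ≤ 2 ^ k := Nat.one_le_two_pow
  have h3 : ((A : ℤ) * 2 ^ k + 1 - -((A : ℤ) * 2 ^ k)).toNat = 2 * A * 2 ^ k + 1 := by
    have : (A : ℤ) * 2 ^ k + 1 - -((A : ℤ) * 2 ^ k) = ((2 * A * 2 ^ k + 1 : ℕ) : ℤ) := by
      push_cast; ring
    rw [this, Int.toNat_natCast]
  rw [h3, pow_add]
  nlinarith

/-- At infinitely many scales a compact set of lower Minkowski dimension less than `γ` meets at
most `2 ^ (γ k)` cubes of generation `k`. -/
lemma IsCompact.exists_cubeCount_le {ι : Type*} [Fintype ι] {E : Set (ι → ℝ)} (hE : IsCompact E)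
    {γ : ℝ} (hγ : lowerMinkDim E < γ) (N : ℕ) :
    ∃ k ≥ N, (cubeCount ((2 : ℝ) ^ (-(k : ℤ))) E : ℝ) ≤ (2 : ℝ) ^ (γ * k) := by
  obtain ⟨A, hA⟩ := hE.exists_nat_abs_le
  have hlog : 0 < Real.log 2 := Real.log_pos one_lt_two
  have hbdd : Filter.IsCoboundedUnder (· ≥ ·) Filter.atTop fun k : ℕ =>
      Real.log (cubeCount ((2 : ℝ) ^ (-(k : ℤ))) E) / (k * Real.log 2) := by
    refine Filter.IsBoundedUnder.isCoboundedUnder_ge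
      (Filter.isBoundedUnder_of_eventually_le (a := (2 * A + 2 : ℝ) * Fintype.card ι) ?_)
    filter_upwards [Filter.eventually_ge_atTop 1] with k hk
    have hk' : (1 : ℝ) ≤ k := by exact_mod_cast hk
    rw [div_le_iff₀ (by positivity)]
    rcases Nat.eq_zero_or_pos (cubeCount ((2 : ℝ) ^ (-(k : ℤ))) E) with h0 | h0
    · rw [h0, Nat.cast_zero, Real.log_zero]
      positivity
    · have h1 : (cubeCount ((2 : ℝ) ^ (-(k : ℤ))) E : ℝ)
          ≤ (2 ^ (2 * A + 1 + k)) ^ Fintype.card ι := by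
        exact_mod_cast cubeCount_le hA k
      refine (Real.log_le_log (by exact_mod_cast h0) h1).trans ?_
      rw [Real.log_pow, Real.log_pow, ← mul_assoc, ← mul_assoc]
      refine mul_le_mul_of_nonneg_right ?_ hlog.le
      push_cast
      rw [mul_comm, mul_right_comm]
      refine mul_le_mul_of_nonneg_right ?_ (Nat.cast_nonneg _)
      nlinarith [Nat.cast_nonneg (α := ℝ) A]
  have hfreq := Filter.frequently_lt_of_liminf_lt hbdd hγ
  obtain ⟨k, hlt, hk⟩ :=
    (hfreq.and_eventually (Filter.eventually_ge_atTop (max N 1))).exists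
  have hk1 : (1 : ℝ) ≤ k := by exact_mod_cast (le_max_right N 1).trans hk
  refine ⟨k, (le_max_left N 1).trans hk, ?_⟩
  rcases Nat.eq_zero_or_pos (cubeCount ((2 : ℝ) ^ (-(k : ℤ))) E) with h0 | h0
  · rw [h0, Nat.cast_zero]
    positivity
  · rw [div_lt_iff₀ (by positivity)] at hlt
    rw [Real.le_rpow_iff_log_le (by exact_mod_cast h0) two_pos]
    linarith

/-- One stage of the construction: below generation `L` there are parameters `a`, `b`, `e` and a
choice of `2 ^ e` children of every cube of generation `L` that avoids `E` at generation
`L + a + 1 + b`. -/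
lemma exists_stage {d n : ℕ} (hd : 1 ≤ d) (hn : 2 ≤ n) {α s : ℝ} (hs0 : 0 ≤ s) (hsd : s < d)
    (hs : ((n : ℝ) - 1) * s < n * d - α) {E : Set (Fin n × Fin d → ℝ)} (hE : IsCompact E)
    (hdim : lowerMinkDim E ≤ α) (L : ℕ) :
    ∃ (a b e : ℕ) (u v : (Fin d → ℕ) → Fin (2 ^ e) → Fin d → ℕ),
      e + 1 = a * d ∧ s * (L + a + 1 + b : ℕ) ≤ e ∧
      (∀ m, Function.Injective (u m)) ∧ (∀ m i j, u m i j < 2 ^ a) ∧ (∀ m i j, v m i j < 2 ^ b) ∧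
      ∀ (m : Fin n → Fin d → ℕ) (i : Fin n → Fin (2 ^ e)), (∀ j k, m j k < 2 ^ L) →
        (Function.Injective fun j => childIndex a b (m j) (u (m j) (i j)) (v (m j) (i j))) →
        (fun q : Fin n × Fin d =>
          (childIndex a b (m q.1) (u (m q.1) (i q.1)) (v (m q.1) (i q.1)) q.2 : ℤ)) ∉
          cubesMeeting ((2 : ℝ) ^ (-((L + a + 1 + b : ℕ) : ℤ))) E := by
  have hd' : (1 : ℝ) ≤ d := by exact_mod_cast hd
  have hn' : (2 : ℝ) ≤ n := by exact_mod_cast hn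
  set η : ℝ := (n * d - α - (n - 1) * s) / 2 with hη
  have hη0 : 0 < η := by rw [hη]; linarith
  obtain ⟨N₁, hN₁⟩ := exists_nat_ge ((d * (L + 2) + 1) / (d - s) : ℝ)
  obtain ⟨N₂, hN₂⟩ := exists_nat_ge ((d * n * (L + 1) + 1 + (n - 1) * (1 + d)) / η : ℝ)
  obtain ⟨K, hK, hcount⟩ := hE.exists_cubeCount_le (γ := α + η) (by linarith) (max N₁ N₂)
  have hK₁ : (d * (L + 2) + 1 : ℝ) ≤ K * (d - s) := by
    rw [← div_le_iff₀ (by linarith)]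
    exact hN₁.trans (by exact_mod_cast (le_max_left N₁ N₂).trans hK)
  have hK₂ : (d * n * (L + 1) + 1 + (n - 1) * (1 + d) : ℝ) ≤ K * η := by
    rw [← div_le_iff₀ hη0]
    exact hN₂.trans (by exact_mod_cast (le_max_right N₁ N₂).trans hK)
  have hpos : 0 < (s * K + 1) / d := by positivity
  set a := ⌈(s * K + 1) / d⌉₊ with ha
  have ha_ge : s * K + 1 ≤ a * d := (div_le_iff₀ (by linarith)).1 (Nat.le_ceil _)
  have ha_le : a * d ≤ s * K + 1 + d := by
    have h := (Nat.ceil_lt_add_one hpos.le).le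
    rw [← ha] at h
    calc (a * d : ℝ) ≤ ((s * K + 1) / d + 1) * d := by gcongr
      _ = s * K + 1 + d := by field_simp
  have ha1 : 0 < a := Nat.ceil_pos.2 hpos
  obtain ⟨e, he⟩ : ∃ e, a * d = e + 1 := Nat.exists_eq_add_one.2 (Nat.mul_pos ha1 hd)
  have he' : (a * d : ℝ) = e + 1 := by exact_mod_cast he
  have hLK : L + a + 1 ≤ K := by
    have : ((L + a + 1 : ℕ) : ℝ) * d ≤ K * d := by push_cast; nlinarith
    exact_mod_cast le_of_mul_le_mul_right this (by linarith)
  clear_value a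
  obtain ⟨b, rfl⟩ := Nat.exists_eq_add_of_le hLK
  have hcard : (cubesMeeting ((2 : ℝ) ^ (-((L + a + 1 + b : ℕ) : ℤ))) E).ncard
      ≤ 2 ^ e * ((2 ^ b) ^ d) ^ n := by
    have h1 : ((2 ^ e * ((2 ^ b) ^ d) ^ n : ℕ) : ℝ) = (2 : ℝ) ^ (e + b * d * n : ℝ) := by
      rw [← pow_mul, ← pow_mul, ← pow_add, mul_assoc]
      push_cast
      rw [← Real.rpow_natCast]
      push_cast
      ring_nf
    rw [← Nat.cast_le (α := ℝ), h1]
    refine hcount.trans (Real.rpow_le_rpow_of_exponent_le one_le_two ?_)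
    push_cast at hK₂ ha_le ⊢
    have h2 : α = n * d - (n - 1) * s - 2 * η := by rw [hη]; ring
    rw [h2]
    have h3 : (n - 1 : ℝ) * (a * d) ≤ (n - 1) * (s * (L + a + 1 + b) + 1 + d) := by
      gcongr
      linarith
    nlinarith
  obtain ⟨u, v, h⟩ := exists_selection (L := L) (a := a) (M := 2 ^ e) (by lia : 0 < n)
    (by rw [← pow_mul, he, pow_succ']) _ (hE.finite_cubesMeeting _) hcard
  exact ⟨a, b, e, u, v, he.symm, by linarith, h⟩

/-- The index of the half-open dyadic cube of generation `p` containing `x`, for `x` in the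
positive orthant. -/
def floorIndex {ι : Type*} (p : ℕ) (x : ι → ℝ) : ι → ℕ := fun j => ⌊2 ^ p * x j⌋₊

lemma floorIndex_eq_div {ι : Type*} (p r : ℕ) (x : ι → ℝ) (j : ι) :
    floorIndex p x j = floorIndex (p + r) x j / 2 ^ r := by
  have h := Nat.floor_div_natCast (2 ^ (p + r) * x j) (2 ^ r)
  rw [floorIndex, floorIndex, ← h]
  congr 1
  push_cast
  field_simp
  ring

lemma floorIndex_eq_of_le {ι : Type*} {p p' : ℕ} (hp : p ≤ p') {x y : ι → ℝ}
    (h : floorIndex p' x = floorIndex p' y) : floorIndex p x = floorIndex p y := by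
  obtain ⟨r, rfl⟩ := Nat.exists_eq_add_of_le hp
  funext j
  rw [floorIndex_eq_div p r, h, ← floorIndex_eq_div]

lemma exists_floorIndex_ne {ι : Type*} {x y : ι → ℝ} (hx : ∀ j, 0 ≤ x j) (hy : ∀ j, 0 ≤ y j)
    (hxy : x ≠ y) : ∃ P, ∀ p ≥ P, floorIndex p x ≠ floorIndex p y := by
  obtain ⟨j, hj⟩ := Function.ne_iff.1 hxy
  obtain ⟨P, hP⟩ := pow_unbounded_of_one_lt (1 / |x j - y j|) one_lt_two
  refine ⟨P, fun p hp h => ?_⟩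
  have hpos : 0 < |x j - y j| := abs_pos.2 (sub_ne_zero.2 hj)
  have h1 := congrFun (floorIndex_eq_of_le hp h) j
  have hP0 : (0 : ℝ) < 2 ^ P := by positivity
  have ax := Nat.floor_le (mul_nonneg hP0.le (hx j))
  have ay := Nat.floor_le (mul_nonneg hP0.le (hy j))
  have bx := Nat.lt_floor_add_one (2 ^ P * x j)
  have bY := Nat.lt_floor_add_one (2 ^ P * y j)
  simp only [floorIndex] at h1
  rw [h1] at ax bx
  rw [div_lt_iff₀ hpos, ← abs_of_pos hP0, ← abs_mul] at hP
  refine absurd hP (not_lt.2 (abs_le.2 ⟨?_, ?_⟩)) <;> nlinarith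

section MassDistribution

open MeasureTheory
open scoped ENNReal NNReal

variable {ι : Type*} [Fintype ι]

lemma measure_floorIndex_le_of_add {ν : Measure (ι → ℝ)} {p r : ℕ} {c : ℝ≥0∞}
    (h : ∀ q, ν {x | floorIndex (p + r) x = q} ≤ c) (q : ι → ℕ) :
    ν {x | floorIndex p x = q} ≤ (2 ^ r) ^ Fintype.card ι * c := by
  classical
  have hsub : {x | floorIndex p x = q} ⊆ ⋃ w : ι → Fin (2 ^ r),
      {x : ι → ℝ | floorIndex (p + r) x = fun j => 2 ^ r * q j + w j} := by
    rintro x rfl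
    refine Set.mem_iUnion.2 ⟨fun j => Fin.ofNat (2 ^ r) (floorIndex (p + r) x j), ?_⟩
    funext j
    rw [floorIndex_eq_div p r]
    exact (Nat.div_add_mod _ _).symm
  calc ν {x | floorIndex p x = q}
      ≤ ∑ w : ι → Fin (2 ^ r), ν {x | floorIndex (p + r) x = fun j => 2 ^ r * q j + w j} :=
        (measure_mono hsub).trans (measure_iUnion_fintype_le _ _)
    _ ≤ ∑ _w : ι → Fin (2 ^ r), c := Finset.sum_le_sum fun w _ => h _
    _ = _ := by simp

lemma measure_le_of_ediam_le {ν : Measure (ι → ℝ)} {p : ℕ} {c : ℝ≥0∞}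
    (h : ∀ q, ν {x | floorIndex p x = q} ≤ c) {t : Set (ι → ℝ)}
    (ht : Metric.ediam t ≤ ENNReal.ofReal ((1 / 2) ^ p)) :
    ν t ≤ 3 ^ Fintype.card ι * c := by
  classical
  rcases t.eq_empty_or_nonempty with rfl | ⟨y, hy⟩
  · simp
  have close : ∀ x ∈ t, ∀ z ∈ t, ∀ j, floorIndex p x j ≤ floorIndex p z j + 1 := by
    intro x hx z hz j
    have h1 : edist (x j) (z j) ≤ ENNReal.ofReal ((1 / 2) ^ p) :=
      (edist_le_pi_edist x z j).trans ((Metric.edist_le_ediam_of_mem hx hz).trans ht)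
    rw [edist_dist, ENNReal.ofReal_le_ofReal_iff (by positivity), Real.dist_eq] at h1
    refine Nat.lt_succ_iff.1 ((Nat.floor_lt' (Nat.succ_ne_zero _)).2 ?_)
    have h4 := Nat.lt_floor_add_one (2 ^ p * z j)
    have h2 : (2 : ℝ) ^ p * (1 / 2) ^ p = 1 := by rw [← mul_pow]; norm_num
    have h3 : (0 : ℝ) < 2 ^ p := by positivity
    simp only [floorIndex]
    push_cast
    nlinarith [(abs_le.1 h1).2]
  have hsub : t ⊆ ⋃ w : ι → Fin 3,
      {x : ι → ℝ | floorIndex p x = fun j => floorIndex p y j + w j - 1} := by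
    intro x hx
    refine Set.mem_iUnion.2 ⟨fun j => ⟨floorIndex p x j + 1 - floorIndex p y j, ?_⟩, ?_⟩
    · have := close x hx y hy j
      lia
    · funext j
      have := close y hy x hx j
      dsimp only
      lia
  calc ν t ≤ ∑ w : ι → Fin 3, ν {x | floorIndex p x = fun j => floorIndex p y j + w j - 1} :=
        (measure_mono hsub).trans (measure_iUnion_fintype_le _ _)
    _ ≤ ∑ _w : ι → Fin 3, c := Finset.sum_le_sum fun w _ => h _
    _ = _ := by simp

/-- The mass distribution principle over dyadic cubes. -/
lemma le_dimH_of_measure_floorIndex_le {ν : Measure (ι → ℝ)} {X : Set (ι → ℝ)} (hX : ν X ≠ 0)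
    {s : ℝ≥0} {P : ℕ}
    (h : ∀ p ≥ P, ∀ q, ν {x | floorIndex p x = q} ≤ (2 : ℝ≥0∞) ^ (1 - s * p : ℝ)) :
    (s : ℝ≥0∞) ≤ dimH X := by
  rcases eq_or_ne s 0 with rfl | hs
  · simp
  have hs0 : (0 : ℝ) < s := by exact_mod_cast pos_iff_ne_zero.2 hs
  set D : ℝ≥0∞ := 3 ^ Fintype.card ι * (2 : ℝ≥0∞) ^ (1 + s : ℝ) with hD
  have hDtop : D ≠ ⊤ :=
    ENNReal.mul_ne_top (by simp) (ENNReal.rpow_ne_top_of_ne_zero two_ne_zero ENNReal.ofNat_ne_top)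
  have hD0 : D ≠ 0 := by
    refine mul_ne_zero (by simp) (ENNReal.rpow_pos two_pos ENNReal.ofNat_ne_top).ne'
  have half : ∀ p : ℕ, ENNReal.ofReal ((1 / 2) ^ p) = (2 : ℝ≥0∞) ^ (-p : ℝ) := by
    intro p
    rw [ENNReal.rpow_neg, ENNReal.rpow_natCast, ENNReal.ofReal_pow (by norm_num), one_div,
      ENNReal.ofReal_inv_of_pos two_pos, ENNReal.ofReal_ofNat, ENNReal.inv_pow]
  have key : ∀ t : Set (ι → ℝ), Metric.ediam t ≤ ENNReal.ofReal ((1 / 2) ^ P) →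
      ν t ≤ D * Metric.ediam t ^ (s : ℝ) := by
    intro t ht
    rcases eq_or_ne (Metric.ediam t) 0 with h0 | h0
    · have hle : ∀ p ≥ P, ν t ≤ 3 ^ Fintype.card ι * (2 * ((2 : ℝ≥0∞) ^ (-s : ℝ)) ^ p) := by
        intro p hp
        refine (measure_le_of_ediam_le (h p hp) (by rw [h0]; exact zero_le)).trans_eq ?_
        rw [sub_eq_add_neg, ENNReal.rpow_add _ _ two_ne_zero ENNReal.ofNat_ne_top,
          ENNReal.rpow_one, ← neg_mul, ENNReal.rpow_mul, ENNReal.rpow_natCast]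
      have hlt : (2 : ℝ≥0∞) ^ (-s : ℝ) < 1 :=
        ENNReal.rpow_lt_one_of_one_lt_of_neg ENNReal.one_lt_two (by linarith)
      have hlim := ENNReal.Tendsto.const_mul (a := 3 ^ Fintype.card ι)
        (ENNReal.Tendsto.const_mul (a := 2) (ENNReal.tendsto_pow_atTop_nhds_zero_of_lt_one hlt)
          (Or.inr ENNReal.ofNat_ne_top)) (Or.inr (by simp))
      rw [mul_zero, mul_zero] at hlim
      exact (ge_of_tendsto hlim (Filter.eventually_atTop.2 ⟨P, hle⟩)).trans zero_le
    · have htop : Metric.ediam t ≠ ⊤ := ne_top_of_le_ne_top ENNReal.ofReal_ne_top ht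
      set δ := (Metric.ediam t).toReal with hδ
      have hδt : Metric.ediam t = ENNReal.ofReal δ := (ENNReal.ofReal_toReal htop).symm
      have hδ0 : 0 < δ := ENNReal.toReal_pos h0 htop
      have hδP : δ ≤ (1 / 2) ^ P := by
        rwa [hδt, ENNReal.ofReal_le_ofReal_iff (by positivity)] at ht
      obtain ⟨p, hp1, hp2⟩ := exists_nat_pow_near_of_lt_one hδ0
        (hδP.trans (pow_le_one₀ (by norm_num) (by norm_num))) (by norm_num : (0 : ℝ) < 1 / 2)
        (by norm_num)
      have hpP : P ≤ p := by
        have := (pow_lt_pow_iff_right_of_lt_one₀ (by norm_num : (0 : ℝ) < 1 / 2)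
          (by norm_num)).1 (hp1.trans_le hδP)
        lia
      refine (measure_le_of_ediam_le (h p hpP)
        (by rw [hδt]; exact ENNReal.ofReal_le_ofReal hp2)).trans ?_
      rw [hD, mul_assoc]
      gcongr
      have hlow : (2 : ℝ≥0∞) ^ (-(p + 1 : ℕ) : ℝ) ≤ Metric.ediam t := by
        rw [← half, hδt]
        exact ENNReal.ofReal_le_ofReal hp1.le
      calc (2 : ℝ≥0∞) ^ (1 - s * p : ℝ)
          = 2 ^ (1 + s : ℝ) * ((2 : ℝ≥0∞) ^ (-(p + 1 : ℕ) : ℝ)) ^ (s : ℝ) := by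
            rw [← ENNReal.rpow_mul, ← ENNReal.rpow_add _ _ two_ne_zero ENNReal.ofNat_ne_top]
            congr 1
            push_cast
            ring
        _ ≤ 2 ^ (1 + s : ℝ) * Metric.ediam t ^ (s : ℝ) := by gcongr
  have hle : D⁻¹ • ν ≤ Measure.hausdorffMeasure (s : ℝ) := by
    refine Measure.le_hausdorffMeasure _ _ (ENNReal.ofReal ((1 / 2) ^ P))
      (ENNReal.ofReal_pos.2 (by positivity)) fun t ht => ?_
    rw [Measure.smul_apply, smul_eq_mul, mul_comm, ← div_eq_mul_inv]
    exact ENNReal.div_le_of_le_mul' (key t ht)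
  refine le_dimH_of_hausdorffMeasure_ne_zero fun hzero => ?_
  have := (hle X).trans_eq hzero
  simp [hX, hDtop] at this

end MassDistribution

/-- The data of a nested selection of dyadic cubes: at stage `k` every cube of generation
`level k` is given `2 ^ e k` children, of generation `level (k + 1)`, in distinct cubes of
generation `level k + a k`. -/
structure SelectionScheme (ι : Type*) where
  level : ℕ → ℕ
  a : ℕ → ℕ
  b : ℕ → ℕ
  e : ℕ → ℕ
  u (k : ℕ) : (ι → ℕ) → Fin (2 ^ e k) → ι → ℕ
  v (k : ℕ) : (ι → ℕ) → Fin (2 ^ e k) → ι → ℕ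
  level_zero : level 0 = 0
  level_succ (k : ℕ) : level (k + 1) = level k + a k + 1 + b k
  u_injective (k : ℕ) (m : ι → ℕ) : Function.Injective (u k m)
  u_lt (k : ℕ) (m : ι → ℕ) (i : Fin (2 ^ e k)) (j : ι) : u k m i j < 2 ^ a k
  v_lt (k : ℕ) (m : ι → ℕ) (i : Fin (2 ^ e k)) (j : ι) : v k m i j < 2 ^ b k

namespace SelectionScheme

open MeasureTheory ProbabilityTheory
open scoped ENNReal NNReal

variable {ι : Type*} (𝒮 : SelectionScheme ι)

/-- An infinite sequence of choices of children. -/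
abbrev Branch : Type := ∀ k, Fin (2 ^ 𝒮.e k)

/-- The index of the cube reached after `k` choices. -/
def index (ω : 𝒮.Branch) : ℕ → ι → ℕ
  | 0 => 0
  | k + 1 => childIndex (𝒮.a k) (𝒮.b k) (index ω k) (𝒮.u k (index ω k) (ω k))
      (𝒮.v k (index ω k) (ω k))

/-- The point determined by a sequence of choices. -/
def point (ω : 𝒮.Branch) : ι → ℝ := fun j => ⨆ k, (𝒮.index ω k j : ℝ) / 2 ^ 𝒮.level k

lemma level_strictMono : StrictMono 𝒮.level :=
  strictMono_nat_of_lt_succ fun k => by rw [𝒮.level_succ]; lia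

lemma index_succ (ω : 𝒮.Branch) (k : ℕ) (j : ι) :
    𝒮.index ω (k + 1) j = 2 ^ (𝒮.b k + 1) * (2 ^ 𝒮.a k * 𝒮.index ω k j +
      𝒮.u k (𝒮.index ω k) (ω k) j) + 𝒮.v k (𝒮.index ω k) (ω k) j := rfl

lemma two_pow_level_succ (k : ℕ) :
    2 ^ 𝒮.level (k + 1) = 2 ^ (𝒮.b k + 1) * 2 ^ 𝒮.a k * 2 ^ 𝒮.level k := by
  rw [𝒮.level_succ, ← pow_add, ← pow_add]
  congr 1
  lia

lemma index_succ_add_one_lt (ω : 𝒮.Branch) (k : ℕ) (j : ι) :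
    𝒮.index ω (k + 1) j + 1 < 2 ^ (𝒮.b k + 1) * 2 ^ 𝒮.a k * (𝒮.index ω k j + 1) := by
  have hu := 𝒮.u_lt k (𝒮.index ω k) (ω k) j
  have hv := 𝒮.v_lt k (𝒮.index ω k) (ω k) j
  rw [𝒮.index_succ]
  calc _ < 2 ^ (𝒮.b k + 1) * (2 ^ 𝒮.a k * 𝒮.index ω k j + 𝒮.u k (𝒮.index ω k) (ω k) j)
        + 2 ^ (𝒮.b k + 1) := by rw [pow_succ]; lia
    _ = 2 ^ (𝒮.b k + 1) * (2 ^ 𝒮.a k * 𝒮.index ω k j +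
        (𝒮.u k (𝒮.index ω k) (ω k) j + 1)) := by ring
    _ ≤ 2 ^ (𝒮.b k + 1) * (2 ^ 𝒮.a k * 𝒮.index ω k j + 2 ^ 𝒮.a k) := by gcongr; exact hu
    _ = _ := by ring

lemma index_lt (ω : 𝒮.Branch) (k : ℕ) (j : ι) : 𝒮.index ω k j < 2 ^ 𝒮.level k := by
  induction k with
  | zero => simp [index]
  | succ k ih =>
    have h := 𝒮.index_succ_add_one_lt ω k j
    rw [𝒮.two_pow_level_succ]
    have : 2 ^ (𝒮.b k + 1) * 2 ^ 𝒮.a k * (𝒮.index ω k j + 1) ≤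
        2 ^ (𝒮.b k + 1) * 2 ^ 𝒮.a k * 2 ^ 𝒮.level k := by gcongr; exact ih
    lia

lemma monotone_lower (ω : 𝒮.Branch) (j : ι) :
    Monotone fun k => (𝒮.index ω k j : ℝ) / 2 ^ 𝒮.level k := by
  refine monotone_nat_of_le_succ fun k => ?_
  have h : 2 ^ (𝒮.b k + 1) * 2 ^ 𝒮.a k * 𝒮.index ω k j ≤ 𝒮.index ω (k + 1) j := by
    rw [𝒮.index_succ]
    lia
  have h' : (2 : ℝ) ^ (𝒮.b k + 1) * 2 ^ 𝒮.a k * 𝒮.index ω k j ≤ 𝒮.index ω (k + 1) j := by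
    exact_mod_cast h
  have h2 : (2 : ℝ) ^ 𝒮.level (k + 1) = 2 ^ (𝒮.b k + 1) * 2 ^ 𝒮.a k * 2 ^ 𝒮.level k := by
    exact_mod_cast 𝒮.two_pow_level_succ k
  rw [div_le_div_iff₀ (by positivity) (by positivity), h2]
  calc (𝒮.index ω k j : ℝ) * (2 ^ (𝒮.b k + 1) * 2 ^ 𝒮.a k * 2 ^ 𝒮.level k)
      = 2 ^ (𝒮.b k + 1) * 2 ^ 𝒮.a k * 𝒮.index ω k j * 2 ^ 𝒮.level k := by ring
    _ ≤ _ := by gcongr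

lemma strictAnti_upper (ω : 𝒮.Branch) (j : ι) :
    StrictAnti fun k => ((𝒮.index ω k j : ℝ) + 1) / 2 ^ 𝒮.level k := by
  refine strictAnti_nat_of_succ_lt fun k => ?_
  have h' : (𝒮.index ω (k + 1) j : ℝ) + 1 <
      2 ^ (𝒮.b k + 1) * 2 ^ 𝒮.a k * (𝒮.index ω k j + 1) := by
    exact_mod_cast 𝒮.index_succ_add_one_lt ω k j
  have h2 : (2 : ℝ) ^ 𝒮.level (k + 1) = 2 ^ (𝒮.b k + 1) * 2 ^ 𝒮.a k * 2 ^ 𝒮.level k := by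
    exact_mod_cast 𝒮.two_pow_level_succ k
  rw [div_lt_div_iff₀ (by positivity) (by positivity), h2]
  calc ((𝒮.index ω (k + 1) j : ℝ) + 1) * 2 ^ 𝒮.level k
      < 2 ^ (𝒮.b k + 1) * 2 ^ 𝒮.a k * (𝒮.index ω k j + 1) * 2 ^ 𝒮.level k := by gcongr
    _ = _ := by ring

lemma lower_le_upper (ω : 𝒮.Branch) (j : ι) (k l : ℕ) :
    (𝒮.index ω k j : ℝ) / 2 ^ 𝒮.level k ≤ (𝒮.index ω l j + 1) / 2 ^ 𝒮.level l := by
  calc (𝒮.index ω k j : ℝ) / 2 ^ 𝒮.level k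
      ≤ 𝒮.index ω (max k l) j / 2 ^ 𝒮.level (max k l) := 𝒮.monotone_lower ω j (le_max_left k l)
    _ ≤ (𝒮.index ω (max k l) j + 1) / 2 ^ 𝒮.level (max k l) := by gcongr; linarith
    _ ≤ _ := (𝒮.strictAnti_upper ω j).antitone (le_max_right k l)

lemma lower_le_point (ω : 𝒮.Branch) (k : ℕ) (j : ι) :
    (𝒮.index ω k j : ℝ) / 2 ^ 𝒮.level k ≤ 𝒮.point ω j :=
  le_ciSup (f := fun k => (𝒮.index ω k j : ℝ) / 2 ^ 𝒮.level k)
    ⟨_, Set.forall_mem_range.2 fun l => 𝒮.lower_le_upper ω j l 0⟩ k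

lemma point_nonneg (ω : 𝒮.Branch) (j : ι) : 0 ≤ 𝒮.point ω j :=
  le_trans (by positivity) (𝒮.lower_le_point ω 0 j)

lemma floorIndex_point (ω : 𝒮.Branch) (k : ℕ) :
    floorIndex (𝒮.level k) (𝒮.point ω) = 𝒮.index ω k := by
  funext j
  have h1 := 𝒮.lower_le_point ω k j
  have h2 : 𝒮.point ω j < (𝒮.index ω k j + 1) / 2 ^ 𝒮.level k :=
    (ciSup_le fun l => 𝒮.lower_le_upper ω j l (k + 1)).trans_lt
      (𝒮.strictAnti_upper ω j (Nat.lt_succ_self k))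
  rw [div_le_iff₀' (by positivity)] at h1
  rw [lt_div_iff₀' (by positivity)] at h2
  exact (Nat.floor_eq_iff (mul_nonneg (by positivity) (𝒮.point_nonneg ω j))).2 ⟨h1, h2⟩

lemma point_mem_unitCube {d : ℕ} (𝒮 : SelectionScheme (Fin d)) (ω : 𝒮.Branch) :
    𝒮.point ω ∈ unitCube d := by
  refine fun j => ⟨𝒮.point_nonneg ω j, ?_⟩
  have h := congrFun (𝒮.floorIndex_point ω 0) j
  simpa [floorIndex, 𝒮.level_zero, index] using h

lemma floorIndex_point_intermediate (ω : 𝒮.Branch) (k : ℕ) (j : ι) :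
    floorIndex (𝒮.level k + 𝒮.a k) (𝒮.point ω) j =
      2 ^ 𝒮.a k * 𝒮.index ω k j + 𝒮.u k (𝒮.index ω k) (ω k) j := by
  have hv : 𝒮.v k (𝒮.index ω k) (ω k) j < 2 ^ (𝒮.b k + 1) :=
    (𝒮.v_lt k _ _ j).trans (Nat.pow_lt_pow_right one_lt_two (Nat.lt_succ_self _))
  have hl : 𝒮.level k + 𝒮.a k + (𝒮.b k + 1) = 𝒮.level (k + 1) := by
    rw [𝒮.level_succ]
    lia
  rw [floorIndex_eq_div _ (𝒮.b k + 1), hl, floorIndex_point, index_succ,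
    Nat.mul_add_div (by positivity), Nat.div_eq_of_lt hv, add_zero]

lemma eq_of_floorIndex_point_eq {ω ω' : 𝒮.Branch} {k : ℕ}
    (h : floorIndex (𝒮.level k + 𝒮.a k) (𝒮.point ω) =
      floorIndex (𝒮.level k + 𝒮.a k) (𝒮.point ω')) {l : ℕ} (hl : l ≤ k) : ω l = ω' l := by
  have hle : 𝒮.level l + 𝒮.a l ≤ 𝒮.level k + 𝒮.a k := by
    rcases hl.eq_or_lt with rfl | hlt
    · rfl
    · have h1 := 𝒮.level_strictMono.monotone (Nat.succ_le_of_lt hlt)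
      rw [Nat.succ_eq_add_one, 𝒮.level_succ] at h1
      lia
  have hmid := floorIndex_eq_of_le hle h
  have hidx : 𝒮.index ω l = 𝒮.index ω' l := by
    rw [← floorIndex_point, ← floorIndex_point]
    exact floorIndex_eq_of_le (Nat.le_add_right _ _) hmid
  apply 𝒮.u_injective l (𝒮.index ω l)
  funext j
  have := congrFun hmid j
  rw [floorIndex_point_intermediate, floorIndex_point_intermediate, ← hidx] at this
  exact Nat.add_left_cancel this

/-- The distribution of independent uniform choices. -/
def branchMeasure : Measure 𝒮.Branch :=
  Measure.infinitePi fun k => uniformOn (Set.univ : Set (Fin (2 ^ 𝒮.e k)))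

instance : IsProbabilityMeasure 𝒮.branchMeasure := by
  unfold branchMeasure
  infer_instance

lemma measurable_index [Finite ι] (k : ℕ) : Measurable fun ω => 𝒮.index ω k := by
  induction k with
  | zero => exact measurable_const
  | succ k ih =>
    exact (Measurable.of_discrete (f := fun p : (ι → ℕ) × Fin (2 ^ 𝒮.e k) =>
      childIndex (𝒮.a k) (𝒮.b k) p.1 (𝒮.u k p.1 p.2) (𝒮.v k p.1 p.2))).comp
      (ih.prodMk (measurable_pi_apply k))

lemma measurable_point [Finite ι] : Measurable 𝒮.point := by
  refine measurable_pi_lambda _ fun j => Measurable.iSup fun k => ?_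
  exact ((Measurable.of_discrete (f := fun q : ℕ => (q : ℝ))).comp
    ((measurable_pi_apply j).comp (𝒮.measurable_index k))).div_const _

lemma measurable_floorIndex (p : ℕ) : Measurable fun x : ι → ℝ => floorIndex p x :=
  measurable_pi_lambda _ fun j =>
    Nat.measurable_floor.comp (measurable_const.mul (measurable_pi_apply j))

lemma map_branchMeasure_intermediate_le [Finite ι] (k : ℕ) (q : ι → ℕ) :
    𝒮.branchMeasure.map 𝒮.point {x | floorIndex (𝒮.level k + 𝒮.a k) x = q} ≤
      (2 : ℝ≥0∞) ^ (-((∑ l ∈ Finset.range (k + 1), 𝒮.e l : ℕ) : ℝ)) := by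
  have hq : MeasurableSet {x : ι → ℝ | floorIndex (𝒮.level k + 𝒮.a k) x = q} :=
    measurable_floorIndex _ (measurableSet_singleton q)
  rw [Measure.map_apply 𝒮.measurable_point hq]
  by_cases hne : ∃ ω₀, floorIndex (𝒮.level k + 𝒮.a k) (𝒮.point ω₀) = q
  · obtain ⟨ω₀, hω₀⟩ := hne
    have hsub : 𝒮.point ⁻¹' {x | floorIndex (𝒮.level k + 𝒮.a k) x = q} ⊆
        Set.pi (Finset.range (k + 1)) fun l => {ω₀ l} := by
      intro ω hω l hl
      exact 𝒮.eq_of_floorIndex_point_eq (hω.trans hω₀.symm)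
        (Nat.lt_succ_iff.1 (Finset.mem_range.1 hl))
    refine (measure_mono hsub).trans_eq ?_
    rw [branchMeasure, Measure.infinitePi_pi _ fun l _ => measurableSet_singleton _,
      ENNReal.rpow_neg, ENNReal.rpow_natCast, ← Finset.prod_pow_eq_pow_sum,
      ENNReal.prod_inv_distrib fun _ _ _ _ _ => by simp]
    simp [uniformOn_univ]
  · have : 𝒮.point ⁻¹' {x | floorIndex (𝒮.level k + 𝒮.a k) x = q} = ∅ :=
      Set.eq_empty_iff_forall_notMem.2 fun ω hω => hne ⟨ω, hω⟩
    rw [this, measure_empty]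
    exact zero_le

lemma map_branchMeasure_le [Fintype ι] {s : ℝ} (hs0 : 0 ≤ s) (hsd : s ≤ Fintype.card ι)
    (he : ∀ k, 𝒮.e k + 1 = 𝒮.a k * Fintype.card ι) {k₀ : ℕ}
    (hs : ∀ k ≥ k₀, s * 𝒮.level (k + 1) ≤ 𝒮.e k) {p : ℕ} (hp : 𝒮.level (k₀ + 1) ≤ p)
    (q : ι → ℕ) :
    𝒮.branchMeasure.map 𝒮.point {x | floorIndex p x = q} ≤ (2 : ℝ≥0∞) ^ (1 - s * p : ℝ) := by
  obtain ⟨k, hk0, hkp, hpk⟩ : ∃ k ≥ k₀, 𝒮.level (k + 1) ≤ p ∧ p < 𝒮.level (k + 2) := by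
    have hex : ∃ l, p < 𝒮.level l := ⟨p + 1, 𝒮.level_strictMono.le_apply⟩
    have h1 := Nat.find_spec hex
    have h2 : k₀ + 1 < Nat.find hex := 𝒮.level_strictMono.lt_iff_lt.1 (hp.trans_lt h1)
    obtain ⟨k, hk⟩ : ∃ k, Nat.find hex = k + 2 := ⟨Nat.find hex - 2, by lia⟩
    refine ⟨k, by lia, not_lt.1 (Nat.find_min hex (by lia)), hk ▸ h1⟩
  have hmid := 𝒮.map_branchMeasure_intermediate_le (k + 1)
  have hkp' : (𝒮.level (k + 1) : ℝ) ≤ p := by exact_mod_cast hkp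
  have hpk' : (p : ℝ) ≤ 𝒮.level (k + 2) := by exact_mod_cast hpk.le
  have hsum : 𝒮.e k + 𝒮.e (k + 1) ≤ ∑ l ∈ Finset.range (k + 1 + 1), 𝒮.e l := by
    rw [Finset.sum_range_succ, Finset.sum_range_succ]
    lia
  have hsum' : (𝒮.e k + 𝒮.e (k + 1) : ℝ) ≤ (∑ l ∈ Finset.range (k + 1 + 1), 𝒮.e l : ℕ) := by
    exact_mod_cast hsum
  rcases le_total p (𝒮.level (k + 1) + 𝒮.a (k + 1)) with hle | hle
  · obtain ⟨r, hr⟩ := Nat.exists_eq_add_of_le hle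
    rw [hr] at hmid
    refine (measure_floorIndex_le_of_add hmid q).trans ?_
    rw [← ENNReal.rpow_natCast, ← ENNReal.rpow_natCast, ← ENNReal.rpow_mul,
      ← ENNReal.rpow_add _ _ two_ne_zero ENNReal.ofNat_ne_top]
    refine ENNReal.rpow_le_rpow_of_exponent_le ENNReal.one_lt_two.le ?_
    have he' : (𝒮.e (k + 1) + 1 : ℝ) = 𝒮.a (k + 1) * Fintype.card ι := by
      exact_mod_cast he (k + 1)
    have hr' : (𝒮.level (k + 1) + 𝒮.a (k + 1) : ℝ) = p + r := by exact_mod_cast hr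
    have := hs k hk0
    nlinarith
  · refine (measure_mono fun x hx => ?_).trans
      ((hmid (fun j => q j / 2 ^ (p - (𝒮.level (k + 1) + 𝒮.a (k + 1))))).trans ?_)
    · obtain ⟨r, rfl⟩ := Nat.exists_eq_add_of_le hle
      obtain rfl : floorIndex _ x = q := hx
      funext j
      rw [Nat.add_sub_cancel_left]
      exact floorIndex_eq_div _ _ _ _
    · refine ENNReal.rpow_le_rpow_of_exponent_le ENNReal.one_lt_two.le ?_
      have := hs (k + 1) (by lia)
      have h3 : s * p ≤ s * 𝒮.level (k + 2) := by gcongr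
      have h4 : (0 : ℝ) ≤ 𝒮.e k := Nat.cast_nonneg _
      linarith

lemma le_dimH_range_point [Fintype ι] {s : ℝ≥0} (hsd : (s : ℝ) ≤ Fintype.card ι)
    (he : ∀ k, 𝒮.e k + 1 = 𝒮.a k * Fintype.card ι)
    (hs : ∀ᶠ k in Filter.atTop, (s : ℝ) * 𝒮.level (k + 1) ≤ 𝒮.e k) :
    (s : ℝ≥0∞) ≤ dimH (Set.range 𝒮.point) := by
  obtain ⟨k₀, hk₀⟩ := Filter.eventually_atTop.1 hs
  refine le_dimH_of_measure_floorIndex_le (ν := 𝒮.branchMeasure.map 𝒮.point)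
    (P := 𝒮.level (k₀ + 1)) (fun h0 => ?_)
    fun p hp q => 𝒮.map_branchMeasure_le s.2 hsd he hk₀ hp q
  have h1 := Measure.le_map_apply_image 𝒮.measurable_point.aemeasurable
    (Set.univ : Set 𝒮.Branch) (μ := 𝒮.branchMeasure)
  rw [Set.image_univ, h0, measure_univ] at h1
  exact one_ne_zero (le_zero_iff.1 h1)

end SelectionScheme

/-- **Theorem 1 (main theorem).** If `Z ⊆ ℝ^{dn}` is a countable union of compact sets of
lower Minkowski dimension at most `α`, with `d ≤ α < dn`, then there is a set
`X ⊆ [0,1)^d` of Hausdorff dimension at least `(nd - α)/(n - 1)` avoiding `Z`. -/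
theorem rough_pattern_avoidance (d n : ℕ) (hd : 1 ≤ d) (hn : 2 ≤ n) (α : ℝ)
    (hαd : (d : ℝ) ≤ α) (hαdn : α < (d : ℝ) * n)
    (Z : Set (Fin n × Fin d → ℝ)) (Y : ℕ → Set (Fin n × Fin d → ℝ))
    (hYcompact : ∀ i, IsCompact (Y i))
    (hYdim : ∀ i, lowerMinkDim (Y i) ≤ α)
    (hZ : Z = ⋃ i, Y i) :
    ∃ X : Set (Fin d → ℝ), X ⊆ unitCube d ∧
      ENNReal.ofReal (((n : ℝ) * d - α) / ((n : ℝ) - 1)) ≤ dimH X ∧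
      ∀ x : Fin n → Fin d → ℝ, (∀ j, x j ∈ X) → Function.Injective x →
        tuple x ∉ Z := by
  have hd' : (1 : ℝ) ≤ d := by exact_mod_cast hd
  have hn' : (2 : ℝ) ≤ n := by exact_mod_cast hn
  set β : ℝ := ((n : ℝ) * d - α) / ((n : ℝ) - 1) with hβ
  have hβ0 : 0 < β := div_pos (by linarith) (by linarith)
  have hβmul : ((n : ℝ) - 1) * β = n * d - α := mul_div_cancel₀ _ (by linarith)
  have hβd : β ≤ d := by
    rw [hβ, div_le_iff₀ (by linarith)]
    linarith
  let s : ℕ → ℝ := fun k => β * (1 - 1 / ((k : ℝ) + 1))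
  have hs_lt : ∀ k, s k < β := fun k => by
    have : 0 < 1 / ((k : ℝ) + 1) := by positivity
    simp only [s]
    nlinarith
  have hs0 : ∀ k, 0 ≤ s k := fun k => by
    have : 1 / ((k : ℝ) + 1) ≤ 1 := (div_le_one (by positivity)).2
      (by linarith [k.cast_nonneg (α := ℝ)])
    exact mul_nonneg hβ0.le (by linarith)
  have hs_tendsto : Filter.Tendsto s Filter.atTop (nhds β) := by
    have h := (tendsto_one_div_add_atTop_nhds_zero_nat (𝕜 := ℝ)).const_sub 1 |>.const_mul β
    rwa [sub_zero, mul_one] at h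
  choose a b e u v he hse hinj hu hv havoid using fun k L =>
    exists_stage hd hn (hs0 k) ((hs_lt k).trans_le hβd)
      (by nlinarith [hs_lt k] : ((n : ℝ) - 1) * s k < n * d - α)
      (hYcompact (Nat.unpair k).1) (hYdim (Nat.unpair k).1) L
  let level : ℕ → ℕ := fun k => Nat.rec 0 (fun k L => L + a k L + 1 + b k L) k
  let 𝒮 : SelectionScheme (Fin d) :=
    { level := level
      a := fun k => a k (level k)
      b := fun k => b k (level k)
      e := fun k => e k (level k)
      u := fun k => u k (level k)
      v := fun k => v k (level k)
      level_zero := rfl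
      level_succ := fun k => rfl
      u_injective := fun k => hinj k (level k)
      u_lt := fun k => hu k (level k)
      v_lt := fun k => hv k (level k) }
  refine ⟨Set.range 𝒮.point, Set.range_subset_iff.2 𝒮.point_mem_unitCube, ?_, ?_⟩
  · refine le_of_forall_lt fun r hr => ?_
    obtain ⟨t, hrt, htβ⟩ := ENNReal.lt_iff_exists_nnreal_btwn.1 hr
    have htβ' : (t : ℝ) < β := by
      rwa [← ENNReal.ofReal_coe_nnreal, ENNReal.ofReal_lt_ofReal_iff hβ0] at htβ
    refine hrt.trans_le (𝒮.le_dimH_range_point (by simpa using (htβ'.trans_le hβd).le)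
      (fun k => by simpa using he k (level k)) ?_)
    filter_upwards [hs_tendsto.eventually (lt_mem_nhds htβ')] with k hk
    exact (mul_le_mul_of_nonneg_right hk.le (Nat.cast_nonneg _)).trans (hse k (level k))
  · intro x hx hxinj hxZ
    rw [hZ] at hxZ
    obtain ⟨i, hi⟩ := Set.mem_iUnion.1 hxZ
    choose ω hω using hx
    have hx0 : ∀ j k, 0 ≤ x j k := fun j k => hω j ▸ 𝒮.point_nonneg (ω j) k
    have hsep : ∀ᶠ p in Filter.atTop, Function.Injective fun j => floorIndex p (x j) := by
      have : ∀ᶠ p in Filter.atTop, ∀ j j', j ≠ j' → floorIndex p (x j) ≠ floorIndex p (x j') := by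
        refine Filter.eventually_all.2 fun j => Filter.eventually_all.2 fun j' => ?_
        by_cases hjj : j = j'
        · exact Filter.Eventually.of_forall fun p h => absurd hjj h
        · obtain ⟨P, hP⟩ := exists_floorIndex_ne (hx0 j) (hx0 j') (hxinj.ne hjj)
          exact Filter.eventually_atTop.2 ⟨P, fun p hp _ => hP p hp⟩
      filter_upwards [this] with p hp j j' h
      by_contra hne
      exact hp j j' hne h
    obtain ⟨P, hP⟩ := Filter.eventually_atTop.1 hsep
    let k := Nat.pair i P
    have hk : (Nat.unpair k).1 = i := by simp [k]
    have hPk : P ≤ 𝒮.level (k + 1) :=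
      (Nat.right_le_pair i P).trans ((Nat.le_succ k).trans 𝒮.level_strictMono.le_apply)
    have hfloor : ∀ j, floorIndex (𝒮.level (k + 1)) (x j) = 𝒮.index (ω j) (k + 1) :=
      fun j => by rw [← hω j, 𝒮.floorIndex_point]
    refine havoid k (level k) (fun j => 𝒮.index (ω j) k) (fun j => ω j k)
      (fun j => 𝒮.index_lt (ω j) k) ?_ ⟨tuple x, mem_dyadicCube_two_pow.2 fun q => ?_, ?_⟩
    · have := hP _ hPk
      simp only [hfloor] at this
      exact this
    · refine (Int.natCast_floor_eq_floor (a := 2 ^ 𝒮.level (k + 1) * x q.1 q.2)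
        (mul_nonneg (by positivity) (hx0 q.1 q.2))).symm.trans ?_
      exact congrArg Nat.cast (congrFun (hfloor q.1) q.2)
    · rw [hk]
      exact hi

end
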